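/- Let P = (1/100)·P₁ + (99/100)·P₂ where P₁ is uniform on [0,1/3] and P₂ is uniform on [2/3,1]. For n ≥ 3, every optimal set of n-means contains no point of the open interval (1/3, 2/3). -/

import Mathlib

open MeasureTheory Set

noncomputable def unif (a b : ℝ) : Measure ℝ :=
  (ENNReal.ofReal (b - a))⁻¹ • (volume.restrict (Icc a b))

noncomputable def mix (p : ℝ) (P₁ P₂ : Measure ℝ) : Measure ℝ :=
  ENNReal.ofReal p • P₁ + ENNReal.ofReal (1 - p) • P₂

noncomputable def distortion (P : Measure ℝ) (γ : Finset ℝ) : ℝ :=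
  ∫ x, sInf ((fun c => (x - c) ^ 2) '' (γ : Set ℝ)) ∂P

noncomputable def quantErr (P : Measure ℝ) (n : ℕ) : ℝ :=
  sInf { v | ∃ γ : Finset ℝ, γ.Nonempty ∧ γ.card ≤ n ∧ v = distortion P γ }

def IsOptimal (P : Measure ℝ) (n : ℕ) (γ : Finset ℝ) : Prop :=
  γ.Nonempty ∧ γ.card ≤ n ∧ distortion P γ = quantErr P n

/-- The squared distance from `x` to the finite set `γ`. -/
noncomputable def sqDist (γ : Finset ℝ) (x : ℝ) : ℝ :=
  sInf ((fun c => (x - c) ^ 2) '' (γ : Set ℝ))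

lemma sqDist_le {γ : Finset ℝ} {c : ℝ} (hc : c ∈ γ) (x : ℝ) : sqDist γ x ≤ (x - c) ^ 2 :=
  csInf_le (γ.finite_toSet.image _).bddBelow (mem_image_of_mem _ hc)

lemma exists_sqDist_eq {γ : Finset ℝ} (hγ : γ.Nonempty) (x : ℝ) :
    ∃ c ∈ γ, sqDist γ x = (x - c) ^ 2 := by
  obtain ⟨c, hc, h⟩ :=
    ((hγ.to_set).image (fun c => (x - c) ^ 2)).csInf_mem (γ.finite_toSet.image _)
  exact ⟨c, hc, h.symm⟩

lemma sqDist_nonneg (γ : Finset ℝ) (x : ℝ) : 0 ≤ sqDist γ x := by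
  apply Real.sInf_nonneg
  rintro _ ⟨c, -, rfl⟩
  positivity

lemma continuous_sqDist {γ : Finset ℝ} (hγ : γ.Nonempty) : Continuous (sqDist γ) := by
  have h : sqDist γ = fun x => γ.inf' hγ (fun c => (x - c) ^ 2) := by
    funext x
    rw [Finset.inf'_eq_csInf_image]
    rfl
  rw [h]
  exact Continuous.finset_inf'_apply hγ fun c _ => by fun_prop

/-- The truncated paraboloid of radius `T` centred at `s`. -/
noncomputable def bump (T s x : ℝ) : ℝ := max (T ^ 2 - (x - s) ^ 2) 0

lemma continuous_bump (T s : ℝ) : Continuous (bump T s) := by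
  unfold bump
  fun_prop

lemma bump_nonneg (T s x : ℝ) : 0 ≤ bump T s x := le_max_right _ _

lemma bump_eq_zero {T s x : ℝ} (hT : 0 ≤ T) (h : T ≤ |x - s|) : bump T s x = 0 := by
  apply max_eq_right
  have : T ^ 2 ≤ |x - s| ^ 2 := by gcongr
  rw [sq_abs] at this
  linarith

lemma setIntegral_bump_le {T s a b p q : ℝ} (hT : 0 ≤ T) (hpq : p ≤ q) (hp : s - T ≤ p)
    (hq : q ≤ s + T) (ha : p ≤ max a (s - T)) (hb : min b (s + T) ≤ q) :
    ∫ x in Icc a b, bump T s x ≤ T ^ 2 * (q - p) - ((q - s) ^ 3 - (p - s) ^ 3) / 3 := by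
  have h1 : ∫ x in Icc a b, bump T s x = ∫ x in Icc a b ∩ Icc p q, bump T s x := by
    apply setIntegral_eq_of_subset_of_forall_sdiff_eq_zero measurableSet_Icc inter_subset_left
    rintro x ⟨⟨hxa, hxb⟩, hx⟩
    apply bump_eq_zero hT
    by_contra! hlt
    obtain ⟨h3, h4⟩ := abs_lt.mp hlt
    refine hx ⟨⟨hxa, hxb⟩, ha.trans (max_le hxa (by linarith)), (le_min hxb (by linarith)).trans hb⟩
  have h2 : ∫ x in Icc a b ∩ Icc p q, bump T s x ≤ ∫ x in Icc p q, bump T s x := by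
    apply setIntegral_mono_set ((continuous_bump T s).continuousOn.integrableOn_Icc)
    · exact Filter.Eventually.of_forall (bump_nonneg T s)
    · exact inter_subset_right.eventuallyLE
  have h3 : ∫ x in Icc p q, bump T s x = ∫ x in Icc p q, (T ^ 2 - (x - s) ^ 2) := by
    apply setIntegral_congr_fun measurableSet_Icc
    rintro x ⟨hx1, hx2⟩
    apply max_eq_left
    nlinarith
  rw [h1]
  refine h2.trans (le_of_eq ?_)
  rw [h3, integral_Icc_eq_integral_Ioc, ← intervalIntegral.integral_of_le hpq,
    intervalIntegral.integral_sub (by simp) (Continuous.intervalIntegrable (by fun_prop) _ _),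
    intervalIntegral.integral_comp_sub_right (fun x => x ^ 2) s, integral_pow]
  simp
  ring

lemma setIntegral_bump_le_full {T : ℝ} (hT : 0 ≤ T) (s a b : ℝ) :
    ∫ x in Icc a b, bump T s x ≤ 4 / 3 * T ^ 3 := by
  refine (setIntegral_bump_le (p := s - T) (q := s + T) hT (by linarith) le_rfl le_rfl
    (le_max_right _ _) (min_le_right _ _)).trans (le_of_eq (by ring))

lemma setIntegral_bump_le_half {T s a b : ℝ} (hT : 0 ≤ T) (hs : s ≤ a ∨ b ≤ s) :
    ∫ x in Icc a b, bump T s x ≤ 2 / 3 * T ^ 3 := by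
  rcases hs with hs | hs
  · refine (setIntegral_bump_le (p := s) (q := s + T) hT (by linarith) (by linarith) le_rfl
      (hs.trans (le_max_left _ _)) (min_le_right _ _)).trans (le_of_eq (by ring))
  · refine (setIntegral_bump_le (p := s - T) (q := s) hT (by linarith) le_rfl (by linarith)
      (le_max_right _ _) ((min_le_left _ _).trans hs)).trans (le_of_eq (by ring))

lemma le_setIntegral_sqDist {γ S : Finset ℝ} (hγ : γ.Nonempty) {a b T : ℝ}
    (hab : a ≤ b) (hT : 0 ≤ T) (hfar : ∀ s ∈ γ, s ∉ S → s ≤ a - T ∨ b + T ≤ s) :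
    T ^ 2 * (b - a) - ∑ s ∈ S, ∫ x in Icc a b, bump T s x ≤ ∫ x in Icc a b, sqDist γ x := by
  have hi : ∀ s ∈ S, Integrable (bump T s) (volume.restrict (Icc a b)) := fun s _ =>
    (continuous_bump T s).continuousOn.integrableOn_Icc
  have hc : Integrable (fun _ : ℝ => T ^ 2) (volume.restrict (Icc a b)) :=
    continuous_const.continuousOn.integrableOn_Icc
  have h : ∫ x in Icc a b, (T ^ 2 - ∑ s ∈ S, bump T s x) =
      T ^ 2 * (b - a) - ∑ s ∈ S, ∫ x in Icc a b, bump T s x := by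
    rw [integral_sub hc (integrable_finsetSum S hi), integral_finsetSum S hi]
    simp [hab, mul_comm]
  rw [← h]
  apply setIntegral_mono_on (hc.sub (integrable_finsetSum S hi))
    (continuous_sqDist hγ).continuousOn.integrableOn_Icc measurableSet_Icc
  rintro x ⟨hxa, hxb⟩
  obtain ⟨s, hs, hsx⟩ := exists_sqDist_eq hγ x
  simp only [hsx, Pi.sub_apply]
  have hsum : ∀ s ∈ S, 0 ≤ bump T s x := fun s _ => bump_nonneg T s x
  by_cases hsS : s ∈ S
  · have h1 := Finset.single_le_sum hsum hsS
    have h2 : T ^ 2 - (x - s) ^ 2 ≤ bump T s x := le_max_left _ _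
    linarith
  · have h1 := Finset.sum_nonneg hsum
    have h2 : T ^ 2 ≤ (x - s) ^ 2 := by
      rcases hfar s hs hsS with h | h <;> nlinarith
    linarith

lemma setIntegral_sqDist_ge {γ S : Finset ℝ} (hS : S ⊆ γ) (hS0 : S.Nonempty) {a b T : ℝ}
    (hab : a ≤ b) (hT : 0 ≤ T) (hfar : ∀ s ∈ γ, s ∉ S → s ≤ a - T ∨ b + T ≤ s) :
    T ^ 2 * (b - a) - S.card * (4 / 3 * T ^ 3) ≤ ∫ x in Icc a b, sqDist γ x := by
  have h1 := le_setIntegral_sqDist (hS0.mono hS) hab hT hfar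
  have h2 := Finset.sum_le_card_nsmul S (fun s => ∫ x in Icc a b, bump T s x) _
    fun s _ => setIntegral_bump_le_full hT s a b
  rw [nsmul_eq_mul] at h2
  linarith

lemma setIntegral_sqDist_ge_of_mem_outside {γ S : Finset ℝ} (hS : S ⊆ γ) {a b T c : ℝ}
    (hab : a ≤ b) (hT : 0 ≤ T) (hfar : ∀ s ∈ γ, s ∉ S → s ≤ a - T ∨ b + T ≤ s)
    (hc : c ∈ S) (hcab : c ≤ a ∨ b ≤ c) :
    T ^ 2 * (b - a) - S.card * (4 / 3 * T ^ 3) + 2 / 3 * T ^ 3 ≤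
      ∫ x in Icc a b, sqDist γ x := by
  have h1 := le_setIntegral_sqDist ⟨c, hS hc⟩ hab hT hfar
  have h2 := Finset.sum_le_card_nsmul (S.erase c) (fun s => ∫ x in Icc a b, bump T s x) _
    fun s _ => setIntegral_bump_le_full hT s a b
  have h3 := Finset.add_sum_erase S (fun s => ∫ x in Icc a b, bump T s x) hc
  have h4 := setIntegral_bump_le_half hT hcab
  have h5 : ((S.erase c).card : ℝ) + 1 = S.card := by
    exact_mod_cast Finset.card_erase_add_one hc
  rw [nsmul_eq_mul] at h2
  rw [← h5]
  linarith

lemma setIntegral_sq_sub (u v s : ℝ) (huv : u ≤ v) :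
    ∫ x in Icc u v, (x - s) ^ 2 = ((v - s) ^ 3 - (u - s) ^ 3) / 3 := by
  rw [integral_Icc_eq_integral_Ioc, ← intervalIntegral.integral_of_le huv,
    intervalIntegral.integral_comp_sub_right (fun x => x ^ 2) s, integral_pow]
  norm_num

/-- The `k` midpoints of the partition of `[a, b]` into `k` equal cells. -/
lemma exists_finset_setIntegral_sqDist_le {a b : ℝ} (hab : a ≤ b) {k : ℕ} (hk : 1 ≤ k) :
    ∃ S : Finset ℝ, S.Nonempty ∧ S.card ≤ k ∧ ∀ γ : Finset ℝ, S ⊆ γ →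
      ∫ x in Icc a b, sqDist γ x ≤ (b - a) ^ 3 / (12 * k ^ 2) := by
  have hk0 : (0 : ℝ) < k := by exact_mod_cast hk
  set T : ℝ := (b - a) / (2 * k) with hTdef
  have hT : 0 ≤ T := div_nonneg (by linarith) (by positivity)
  have hTk : 2 * k * T = b - a := by rw [hTdef]; field_simp
  refine ⟨(Finset.range k).image fun i : ℕ => a + (2 * i + 1) * T,
    (Finset.nonempty_range_iff.mpr (by lia)).image _,
    Finset.card_image_le.trans (Finset.card_range k).le, fun γ hγ => ?_⟩
  have hmem : ∀ i < k, a + (2 * (i : ℝ) + 1) * T ∈ γ := fun i hi =>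
    hγ (Finset.mem_image_of_mem _ (Finset.mem_range.mpr hi))
  have hγ0 : γ.Nonempty := ⟨_, hmem 0 hk⟩
  have hcont := continuous_sqDist hγ0
  have hsum := intervalIntegral.sum_integral_adjacent_intervals (μ := volume) (f := sqDist γ)
    (a := fun i : ℕ => a + 2 * (i : ℝ) * T) (n := k)
    fun i _ => hcont.intervalIntegrable _ _
  have hend : a + 2 * (k : ℝ) * T = b := by linarith
  simp only [Nat.cast_zero, mul_zero, zero_mul, add_zero, hend] at hsum
  rw [integral_Icc_eq_integral_Ioc, ← intervalIntegral.integral_of_le hab, ← hsum]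
  have hcell : ∀ i ∈ Finset.range k,
      ∫ x in (a + 2 * (i : ℝ) * T)..(a + 2 * ((i + 1 : ℕ) : ℝ) * T), sqDist γ x ≤
        2 / 3 * T ^ 3 := by
    intro i hi
    have hle : a + 2 * (i : ℝ) * T ≤ a + 2 * ((i + 1 : ℕ) : ℝ) * T := by
      push_cast; nlinarith
    rw [intervalIntegral.integral_of_le hle, ← integral_Icc_eq_integral_Ioc]
    refine (setIntegral_mono_on hcont.continuousOn.integrableOn_Icc
      (ContinuousOn.integrableOn_Icc (by fun_prop)) measurableSet_Icc
      fun x _ => sqDist_le (hmem i (Finset.mem_range.mp hi)) x).trans (le_of_eq ?_)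
    rw [setIntegral_sq_sub _ _ _ hle]
    push_cast
    ring
  refine (Finset.sum_le_card_nsmul _ _ _ hcell).trans (le_of_eq ?_)
  rw [Finset.card_range, nsmul_eq_mul, ← hTk]
  field_simp
  ring

lemma distortion_mix_unif {γ : Finset ℝ} (hγ : γ.Nonempty) :
    distortion (mix (1/100) (unif 0 (1/3)) (unif (2/3) 1)) γ =
      3 / 100 * (∫ x in Icc 0 (1/3), sqDist γ x) +
        297 / 100 * ∫ x in Icc (2/3) 1, sqDist γ x := by
  have hi : ∀ a b : ℝ, Integrable (sqDist γ) (volume.restrict (Icc a b)) := fun a b =>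
    (continuous_sqDist hγ).continuousOn.integrableOn_Icc
  have hfin : ∀ a b : ℝ, a < b → (ENNReal.ofReal (b - a))⁻¹ ≠ ⊤ := fun a b h => by
    simpa using h
  change ∫ x, sqDist γ x ∂_ = _
  rw [mix, unif, unif, integral_add_measure
      (((hi _ _).smul_measure (hfin _ _ (by norm_num))).smul_measure ENNReal.ofReal_ne_top)
      (((hi _ _).smul_measure (hfin _ _ (by norm_num))).smul_measure ENNReal.ofReal_ne_top)]
  simp only [integral_smul_measure, ENNReal.toReal_inv, smul_eq_mul]
  rw [ENNReal.toReal_ofReal (by norm_num), ENNReal.toReal_ofReal (by norm_num),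
    ENNReal.toReal_ofReal (by norm_num), ENNReal.toReal_ofReal (by norm_num)]
  ring

lemma quantErr_mix_unif_le {n k m : ℕ} (hk : 1 ≤ k) (hm : 1 ≤ m) (hn : k + m ≤ n) :
    quantErr (mix (1/100) (unif 0 (1/3)) (unif (2/3) 1)) n ≤
      1 / (10800 * (k : ℝ) ^ 2) + 99 / (10800 * (m : ℝ) ^ 2) := by
  obtain ⟨S, hS0, hSk, hS⟩ :=
    exists_finset_setIntegral_sqDist_le (a := 0) (b := 1/3) (by norm_num) hk
  obtain ⟨R, -, hRm, hR⟩ :=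
    exists_finset_setIntegral_sqDist_le (a := 2/3) (b := 1) (by norm_num) hm
  have hle : quantErr (mix (1/100) (unif 0 (1/3)) (unif (2/3) 1)) n ≤
      distortion (mix (1/100) (unif 0 (1/3)) (unif (2/3) 1)) (S ∪ R) := by
    apply csInf_le
    · refine ⟨0, ?_⟩
      rintro _ ⟨γ, -, -, rfl⟩
      exact integral_nonneg (sqDist_nonneg γ)
    · exact ⟨S ∪ R, hS0.inl, (Finset.card_union_le S R).trans (by lia), rfl⟩
  rw [distortion_mix_unif hS0.inl] at hle
  have h1 := hS (S ∪ R) Finset.subset_union_left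
  have h2 := hR (S ∪ R) Finset.subset_union_right
  have hk0 : (0 : ℝ) < k := by exact_mod_cast hk
  have hm0 : (0 : ℝ) < m := by exact_mod_cast hm
  have e1 : (1 / 3 - 0 : ℝ) ^ 3 / (12 * (k : ℝ) ^ 2) = 100 / 3 * (1 / (10800 * (k : ℝ) ^ 2)) := by
    field_simp; norm_num
  have e2 : (1 - 2 / 3 : ℝ) ^ 3 / (12 * (m : ℝ) ^ 2) =
      100 / 297 * (99 / (10800 * (m : ℝ) ^ 2)) := by
    field_simp; norm_num
  rw [e1] at h1
  rw [e2] at h2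
  linarith

/-- Value of the covering lower bound at the optimal radius for cells of a partition of an
interval of length `1/3` into `k` parts. -/
lemma covering_bound_eq {k : ℝ} (hk : 0 < k) :
    (1 / (6 * k)) ^ 2 * (1 / 3) - k * (4 / 3 * (1 / (6 * k)) ^ 3) = 1 / (324 * k ^ 2) := by
  field_simp
  norm_num

theorem stmt10 (n : ℕ) (hn : 3 ≤ n) (γ : Finset ℝ)
    (hγ : IsOptimal (mix (1/100) (unif 0 (1/3)) (unif (2/3) 1)) n γ) :
    ∀ c ∈ γ, c ∉ Ioo (1/3 : ℝ) (2/3) := by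
  rintro c hc ⟨hc1, hc2⟩
  obtain ⟨hγ0, hcard, hopt⟩ := hγ
  rw [distortion_mix_unif hγ0] at hopt
  have hL0 : 0 ≤ ∫ x in Icc (0 : ℝ) (1/3), sqDist γ x := integral_nonneg (sqDist_nonneg γ)
  have hint : ∀ a b : ℝ, IntegrableOn (sqDist γ) (Icc a b) := fun a b =>
    (continuous_sqDist hγ0).continuousOn.integrableOn_Icc
  have hpoly : ∀ a b : ℝ, IntegrableOn (fun x => (x - 1/2) ^ 2) (Icc a b) := fun a b =>
    ContinuousOn.integrableOn_Icc (by fun_prop)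
  set S := γ.filter (· ≤ 1/2)
  set R := γ.filter (¬ · ≤ 1/2)
  have hSR : S.card + R.card = γ.card := Finset.card_filter_add_card_filter_not _
  rcases R.eq_empty_or_nonempty with hR0 | hR0
  · have hall : ∀ s ∈ γ, s ≤ 1/2 := by
      intro s hs
      by_contra hlt
      exact Finset.notMem_empty s (hR0 ▸ Finset.mem_filter.mpr ⟨hs, hlt⟩)
    have h1 : ∫ x in Icc (2/3 : ℝ) 1, (x - 1/2) ^ 2 ≤ ∫ x in Icc (2/3) 1, sqDist γ x := by
      apply setIntegral_mono_on (hpoly _ _) (hint _ _) measurableSet_Icc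
      rintro x ⟨hx1, hx2⟩
      obtain ⟨s, hs, hsx⟩ := exists_sqDist_eq hγ0 x
      rw [hsx]
      have := hall s hs
      gcongr
      linarith
    rw [setIntegral_sq_sub _ _ _ (by norm_num)] at h1
    have h2 := quantErr_mix_unif_le (n := n) (k := 1) (m := 2) le_rfl (by norm_num) (by lia)
    norm_num at h1 h2
    linarith
  rcases S.eq_empty_or_nonempty with hS0 | hS0
  · have hall : ∀ s ∈ γ, 1/2 < s := by
      intro s hs
      by_contra! hlt
      exact Finset.notMem_empty s (hS0 ▸ Finset.mem_filter.mpr ⟨hs, hlt⟩)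
    have h1 : ∫ x in Icc (0 : ℝ) (1/3), (x - 1/2) ^ 2 ≤ ∫ x in Icc 0 (1/3), sqDist γ x := by
      apply setIntegral_mono_on (hpoly _ _) (hint _ _) measurableSet_Icc
      rintro x ⟨hx1, hx2⟩
      obtain ⟨s, hs, hsx⟩ := exists_sqDist_eq hγ0 x
      rw [hsx]
      have := hall s hs
      nlinarith
    rw [setIntegral_sq_sub _ _ _ (by norm_num)] at h1
    rcases hn.eq_or_lt with rfl | hn4
    · have h2 := quantErr_mix_unif_le (n := 3) (k := 1) (m := 2) le_rfl (by norm_num) le_rfl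
      have h3 := setIntegral_sqDist_ge_of_mem_outside (Finset.Subset.refl γ) (a := 2/3) (b := 1)
        (T := 1/18) (by norm_num) (by norm_num) (fun s hs hs' => absurd hs hs') hc
        (Or.inl hc2.le)
      have h4 : (γ.card : ℝ) ≤ 3 := by exact_mod_cast hcard
      norm_num at h1 h2 h3
      linarith
    · have h2 := quantErr_mix_unif_le (n := n) (k := 1) (m := 3) le_rfl (by norm_num) (by lia)
      have hR1 : 0 ≤ ∫ x in Icc (2/3 : ℝ) 1, sqDist γ x := integral_nonneg (sqDist_nonneg γ)
      norm_num at h1 h2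
      linarith
  have hS1 : (1 : ℝ) ≤ S.card := by exact_mod_cast hS0.card_pos
  have hR1 : (1 : ℝ) ≤ R.card := by exact_mod_cast hR0.card_pos
  have hT : ∀ k : ℝ, 1 ≤ k → 0 < 1 / (6 * k) ∧ 1 / (6 * k) ≤ 1 / 6 := fun k hk =>
    ⟨by positivity, one_div_le_one_div_of_le (by norm_num) (by linarith)⟩
  obtain ⟨hTS, hTS'⟩ := hT _ hS1
  obtain ⟨hTR, hTR'⟩ := hT _ hR1
  have hfarS : ∀ s ∈ γ, s ∉ S →
      s ≤ 0 - 1 / (6 * (S.card : ℝ)) ∨ 1/3 + 1 / (6 * (S.card : ℝ)) ≤ s := by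
    intro s hs hsS
    have : 1/2 < s := by
      by_contra! h
      exact hsS (Finset.mem_filter.mpr ⟨hs, h⟩)
    right
    linarith
  have hfarR : ∀ s ∈ γ, s ∉ R →
      s ≤ 2/3 - 1 / (6 * (R.card : ℝ)) ∨ 1 + 1 / (6 * (R.card : ℝ)) ≤ s := by
    intro s hs hsR
    have : s ≤ 1/2 := by
      by_contra h
      exact hsR (Finset.mem_filter.mpr ⟨hs, h⟩)
    left
    linarith
  have hquant := quantErr_mix_unif_le (n := n) hS0.card_pos hR0.card_pos (by lia)
  have hbS := covering_bound_eq (k := S.card) (by linarith)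
  have hbR := covering_bound_eq (k := R.card) (by linarith)
  have hgeS := setIntegral_sqDist_ge (Finset.filter_subset _ γ) hS0 (by norm_num) hTS.le hfarS
  have hgeR := setIntegral_sqDist_ge (Finset.filter_subset _ γ) hR0 (by norm_num) hTR.le hfarR
  have e1 : 1 / (10800 * (S.card : ℝ) ^ 2) = 3 / 100 * (1 / (324 * (S.card : ℝ) ^ 2)) := by
    field_simp; norm_num
  have e2 : 99 / (10800 * (R.card : ℝ) ^ 2) = 297 / 100 * (1 / (324 * (R.card : ℝ) ^ 2)) := by
    field_simp; norm_num
  rw [e1, e2, ← hbS, ← hbR] at hquant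
  by_cases hcm : c ≤ 1/2
  · have hgt := setIntegral_sqDist_ge_of_mem_outside (Finset.filter_subset _ γ) (by norm_num)
      hTS.le hfarS (Finset.mem_filter.mpr ⟨hc, hcm⟩) (Or.inr hc1.le)
    have hpos : 0 < 2 / 3 * (1 / (6 * (S.card : ℝ))) ^ 3 := by positivity
    linarith
  · have hgt := setIntegral_sqDist_ge_of_mem_outside (Finset.filter_subset _ γ) (by norm_num)
      hTR.le hfarR (Finset.mem_filter.mpr ⟨hc, hcm⟩) (Or.inl hc2.le)
    have hpos : 0 < 2 / 3 * (1 / (6 * (R.card : ℝ))) ^ 3 := by positivity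
    linarith
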